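/- arXiv:1703.05252 — 2 statements merged into one kernel-verified Lean document; each statement's English description precedes it below -/
import Mathlib

section
/- For all integers t, v ≥ 2 and k ≥ t, every v^t × k array over a v-symbol alphabet covers at most c_{t,v} · k^t / t! of the t-subsets of its columns, where c_{t,v} = ∏_{i=0}^{t−1} (v^t − v^i)/(v^t − 1). -/
/-- An array `A` (rows `R`, columns `Fin k`) over an alphabet `S` covers a set `Q` of
columns if every assignment of symbols to the columns of `Q` occurs in some row. -/
def Covers {R : Type*} {k : ℕ} {S : Type*} (A : R → Fin k → S) (Q : Finset (Fin k)) : Prop :=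
  ∀ f : Fin k → S, ∃ r : R, ∀ j ∈ Q, A r j = f j

/-- The rows in `R` of the array `A` realize every assignment of symbols to the columns of `Q`. -/
def CoversOn {ρ C S : Type*} (A : ρ → C → S) (R : Finset ρ) (Q : Finset C) : Prop :=
  ∀ f : C → S, ∃ r ∈ R, ∀ j ∈ Q, A r j = f j

section

open scoped Classical
open Finset

variable {ρ C S : Type*}

theorem CoversOn.pow_card_le [Fintype S] [Nonempty S] {A : ρ → C → S} {R : Finset ρ}
    {Q : Finset C} (h : CoversOn A R Q) : Fintype.card S ^ #Q ≤ #R := by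
  have hsurj : Function.Surjective (fun (r : R) (j : Q) => A r j) := by
    intro g
    obtain ⟨r, hr, hrg⟩ :=
      h (fun j => if hj : j ∈ Q then g ⟨j, hj⟩ else Classical.arbitrary S)
    refine ⟨⟨r, hr⟩, funext fun j => ?_⟩
    simpa using hrg j j.2
  simpa using Fintype.card_le_of_surjective _ hsurj

theorem CoversOn.filter {A : ρ → C → S} {R : Finset ρ} {Q : Finset C} (h : CoversOn A R Q)
    {j : C} (hj : j ∈ Q) (s : S) : CoversOn A {r ∈ R | A r j = s} (Q.erase j) := by
  intro f
  obtain ⟨r, hr, hrf⟩ := h (Function.update f j s)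
  refine ⟨r, mem_filter.2 ⟨hr, by simpa using hrf j hj⟩, fun i hi => ?_⟩
  obtain ⟨hij, hiQ⟩ := mem_erase.1 hi
  simpa [hij] using hrf i hiQ

/-- If `R` has exactly `v ^ #Q` rows and covers `Q`, then every column of `Q` is balanced. -/
theorem CoversOn.card_filter [Fintype S] [Nonempty S] {A : ρ → C → S} {R : Finset ρ}
    {Q : Finset C} {n : ℕ} (h : CoversOn A R Q) (hQ : #Q = n + 1)
    (hR : #R = Fintype.card S ^ (n + 1)) {j : C} (hj : j ∈ Q) (s : S) :
    #{r ∈ R | A r j = s} = Fintype.card S ^ n := by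
  have hle : ∀ s ∈ (univ : Finset S), Fintype.card S ^ n ≤ #{r ∈ R | A r j = s} := by
    intro s _
    have := (h.filter hj s).pow_card_le
    rwa [card_erase_of_mem hj, hQ, Nat.add_sub_cancel] at this
  have hsum : ∑ s : S, #{r ∈ R | A r j = s} = #R :=
    (card_eq_sum_card_fiberwise (fun _ _ => mem_coe.2 (mem_univ _))).symm
  have heq : ∑ _s : S, Fintype.card S ^ n = ∑ s : S, #{r ∈ R | A r j = s} := by
    rw [hsum, hR, sum_const, card_univ, smul_eq_mul, pow_succ']
  exact ((sum_eq_sum_iff_of_le hle).1 heq s (mem_univ s)).symm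

theorem CoversOn.card_filter_filter [Fintype S] [Nonempty S] {A : ρ → C → S} {R : Finset ρ}
    {Q : Finset C} {n : ℕ} (h : CoversOn A R Q) (hQ : #Q = n + 2)
    (hR : #R = Fintype.card S ^ (n + 2)) {i j : C} (hi : i ∈ Q) (hj : j ∈ Q) (hij : i ≠ j)
    (s s' : S) :
    #{r ∈ R | A r i = s ∧ A r j = s'} = Fintype.card S ^ n := by
  rw [← filter_filter]
  refine (h.filter hi s).card_filter ?_ (h.card_filter hQ hR hi s) (mem_erase.2 ⟨hij.symm, hj⟩) s'
  rw [card_erase_of_mem hi, hQ]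
  rfl

/-- The Plackett–Burman bound on the number of pairwise orthogonal columns. -/
theorem card_mul_le_of_pairwise_orthogonal {A : ρ → C → S} {R : Finset ρ} {B : Finset C}
    {u v : ℕ} (hu : 1 ≤ u) (hv : 2 ≤ v) (hR : #R = u * v ^ 2)
    (h₁ : ∀ i ∈ B, ∀ s, #{r ∈ R | A r i = s} = u * v)
    (h₂ : ∀ i ∈ B, ∀ j ∈ B, i ≠ j → ∀ s s', #{r ∈ R | A r i = s ∧ A r j = s'} = u) :
    (#B : ℝ) * (v - 1) ≤ u * v ^ 2 - 1 := by
  have hu' : (1 : ℝ) ≤ u := by exact_mod_cast hu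
  have hv' : (2 : ℝ) ≤ v := by exact_mod_cast hv
  rcases B.eq_empty_or_nonempty with rfl | hB
  · simp only [card_empty, Nat.cast_zero, zero_mul]
    nlinarith
  have hb : (0 : ℝ) < #B := by exact_mod_cast hB.card_pos
  obtain ⟨r₀, hr₀⟩ : R.Nonempty := by
    rw [← card_pos, hR]; positivity
  let x : ρ → ℝ := fun r => ∑ j ∈ B, if A r j = A r₀ j then 1 else 0
  have hx₀ : x r₀ = #B := by simp [x]
  have hsum : ∑ r ∈ R, x r = #B * (u * v) := by
    rw [sum_comm, ← nsmul_eq_mul, ← sum_const]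
    refine sum_congr rfl fun j hj => ?_
    rw [sum_boole, h₁ j hj]
    push_cast
    rfl
  have hsq : ∑ r ∈ R, x r ^ 2 = #B * (u * v + (#B - 1) * u) := by
    have hexp : ∀ r, x r ^ 2 =
        ∑ i ∈ B, ∑ j ∈ B, if A r i = A r₀ i ∧ A r j = A r₀ j then 1 else 0 := by
      intro r
      rw [sq, sum_mul_sum]
      refine sum_congr rfl fun i _ => sum_congr rfl fun j _ => ?_
      rw [ite_zero_mul_ite_zero, mul_one]
    simp_rw [hexp]
    rw [sum_comm, ← nsmul_eq_mul, ← sum_const]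
    refine sum_congr rfl fun i hi => ?_
    rw [sum_comm, ← add_sum_erase _ _ hi]
    congr 1
    · simp only [and_self]
      rw [sum_boole, h₁ i hi]
      push_cast
      rfl
    · rw [← Nat.cast_pred hB.card_pos, ← card_erase_of_mem hi, ← nsmul_eq_mul, ← sum_const]
      refine sum_congr rfl fun j hj => ?_
      rw [sum_boole, h₂ i hi j (mem_of_mem_erase hj) (ne_of_mem_erase hj).symm]
  have hcs := sq_sum_le_card_mul_sum_sq (s := R.erase r₀) (f := x)
  have hcard : (#(R.erase r₀) : ℝ) = u * v ^ 2 - 1 := by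
    rw [card_erase_of_mem hr₀, Nat.cast_pred (card_pos.2 ⟨r₀, hr₀⟩), hR]
    push_cast
    rfl
  have e₁ := add_sum_erase R x hr₀
  have e₂ := add_sum_erase R (fun r => x r ^ 2) hr₀
  simp only [hx₀, hsum, hsq] at e₁ e₂
  rw [hcard, eq_sub_of_add_eq' e₁, eq_sub_of_add_eq' e₂] at hcs
  have hfac : 0 ≤ ((#B : ℝ) * (u * (v - 1))) * ((u * v ^ 2 - 1) - #B * (v - 1)) := by
    nlinarith
  have hpos : (0 : ℝ) < (#B : ℝ) * (u * (v - 1)) := by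
    have : (0 : ℝ) < v - 1 := by linarith
    positivity
  linarith [nonneg_of_mul_nonneg_right hfac hpos]

/-- The Caro–Wei theorem, for cliques: a finite graph on `K` has a clique of size at least
the sum over `j ∈ K` of the inverse of the number of non-neighbours of `j`, itself included. -/
theorem exists_clique_sum_inv_le (G : SimpleGraph C) (K : Finset C) :
    ∃ B ⊆ K, G.IsClique B ∧ ∑ j ∈ K, (#{i ∈ K | ¬ G.Adj j i} : ℝ)⁻¹ ≤ #B := by
  induction K using Finset.strongInduction with
  | H K ih =>
    rcases K.eq_empty_or_nonempty with rfl | hK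
    · exact ⟨∅, by simp⟩
    obtain ⟨w, hw, hmin⟩ := exists_min_image K (fun j => #{i ∈ K | ¬ G.Adj j i}) hK
    have hpos : ∀ K' : Finset C, ∀ j ∈ K', 0 < #{i ∈ K' | ¬ G.Adj j i} := fun K' j hj =>
      card_pos.2 ⟨j, mem_filter.2 ⟨hj, G.loopless.irrefl j⟩⟩
    obtain ⟨B, hBK, hB, hle⟩ := ih {i ∈ K | G.Adj w i}
      (filter_ssubset.2 ⟨w, hw, G.loopless.irrefl w⟩)
    have hwB : w ∉ B := fun h => G.loopless.irrefl w (mem_filter.1 (hBK h)).2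
    refine ⟨insert w B, insert_subset hw (hBK.trans (filter_subset _ _)), ?_, ?_⟩
    · rw [coe_insert]
      exact hB.insert fun b hb _ => (mem_filter.1 (hBK hb)).2
    rw [card_insert_of_notMem hwB, Nat.cast_succ,
      ← sum_filter_add_sum_filter_not K (fun i => G.Adj w i)]
    refine add_le_add ((sum_le_sum fun j hj => ?_).trans hle) ?_
    · have := hpos _ j hj
      gcongr
      exact filter_subset _ _
    · calc ∑ j ∈ K with ¬ G.Adj w j, (#{i ∈ K | ¬ G.Adj j i} : ℝ)⁻¹
          ≤ ∑ j ∈ K with ¬ G.Adj w j, (#{i ∈ K | ¬ G.Adj w i} : ℝ)⁻¹ := by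
            refine sum_le_sum fun j hj => ?_
            have := hpos _ w hw
            have := hmin j (mem_filter.1 hj).1
            gcongr
        _ = 1 := by
            rw [sum_const, nsmul_eq_mul, mul_inv_cancel₀]
            exact_mod_cast Nat.ne_of_gt (hpos _ w hw)

/-- `x * (1 - x) ^ (p + 1)` lies below its tangent line at `a` when `a ≤ 1 / (p + 1)`. -/
theorem mul_one_sub_pow_le_tangent {a x : ℝ} (ha : 0 ≤ a) (hx : x ≤ 1) (p : ℕ)
    (hp : (p + 1) * a ≤ 1) :
    x * (1 - x) ^ (p + 1) ≤ (1 - a) ^ p * (x * (1 - (p + 2) * a) + (p + 1) * a ^ 2) := by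
  induction p with
  | zero => norm_num; nlinarith [sq_nonneg (x - a)]
  | succ p ih =>
    push_cast at hp ⊢
    have hp' : (p + 1) * a ≤ 1 := by linarith
    have ha1 : 0 ≤ 1 - a := by nlinarith [mul_nonneg (Nat.cast_nonneg (α := ℝ) p) ha]
    have hquad : 0 ≤ (1 - (p + 2) * a) * (x - a) ^ 2 :=
      mul_nonneg (by linarith) (sq_nonneg _)
    calc x * (1 - x) ^ (p + 1 + 1) = x * (1 - x) ^ (p + 1) * (1 - x) := by ring
      _ ≤ (1 - a) ^ p * (x * (1 - (p + 2) * a) + (p + 1) * a ^ 2) * (1 - x) :=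
        mul_le_mul_of_nonneg_right (ih hp') (by linarith)
      _ = (1 - a) ^ p * ((x * (1 - (p + 2) * a) + (p + 1) * a ^ 2) * (1 - x)) := by ring
      _ ≤ (1 - a) ^ p * ((1 - a) * (x * (1 - (p + 1 + 2) * a) + (p + 1 + 1) * a ^ 2)) :=
        mul_le_mul_of_nonneg_left (by linarith) (pow_nonneg ha1 p)
      _ = _ := by ring

theorem sum_pow_le_of_sum_inv_le {ι : Type*} {K : Finset ι} {d : ι → ℝ} {m : ℝ} (p : ℕ)
    (hm : p + 1 ≤ m) (hd₀ : ∀ j ∈ K, 0 ≤ d j) (hd : ∀ j ∈ K, d j < #K)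
    (hsum : ∑ j ∈ K, (#K - d j)⁻¹ ≤ m) :
    ∑ j ∈ K, d j ^ (p + 1) ≤ #K * (#K * (1 - m⁻¹)) ^ (p + 1) := by
  rcases K.eq_empty_or_nonempty with rfl | hK
  · simp
  have hk : (0 : ℝ) < #K := by exact_mod_cast hK.card_pos
  set k : ℝ := (#K : ℝ) with hkdef
  have hp0 : (0 : ℝ) ≤ p := Nat.cast_nonneg p
  have hm0 : 0 < m := by linarith
  set a := m⁻¹ with hadef
  have ha : 0 < a := inv_pos.2 hm0
  have hma : m * a = 1 := mul_inv_cancel₀ hm0.ne'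
  have hpa : (p + 1) * a ≤ 1 := by nlinarith
  have ha1 : 0 ≤ 1 - a := by nlinarith
  have hterm : ∀ j ∈ K, d j ^ (p + 1) ≤ k ^ (p + 1) *
      ((1 - a) ^ p * (1 - (p + 2) * a) + (1 - a) ^ p * (p + 1) * a ^ 2 * k * (k - d j)⁻¹) := by
    intro j hj
    have he : 0 < k - d j := sub_pos.2 (hd j hj)
    have hx : (k - d j) / k ≤ 1 := (div_le_one hk).2 (by linarith [hd₀ j hj])
    have hx0 : 0 < (k - d j) / k := div_pos he hk
    have ht := mul_one_sub_pow_le_tangent ha.le hx p hpa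
    rw [mul_comm, ← le_div_iff₀ hx0] at ht
    have h1 : 1 - (k - d j) / k = d j / k := by field_simp; ring
    rw [h1, div_pow, div_le_iff₀ (by positivity)] at ht
    refine ht.trans (le_of_eq ?_)
    field_simp
  refine (sum_le_sum hterm).trans ?_
  rw [← mul_sum, sum_add_distrib, sum_const, nsmul_eq_mul, ← hkdef, ← mul_sum]
  calc _ ≤ k ^ (p + 1) * (k * ((1 - a) ^ p * (1 - (p + 2) * a)) +
        (1 - a) ^ p * (p + 1) * a ^ 2 * k * m) := by gcongr
    _ = k * (k * (1 - a)) ^ (p + 1) := by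
      have : a ^ 2 * m = a := by rw [sq, mul_assoc, mul_comm a m, hma, mul_one]
      rw [mul_pow]
      linear_combination (k ^ (p + 1) * k * (1 - a) ^ p * (p + 1)) * this

theorem prod_range_succ_pow_sub_div {v : ℝ} (hv : 1 < v) {t : ℕ} (ht : t ≠ 0) :
    ∏ i ∈ range (t + 1), (v ^ (t + 1) - v ^ i) / (v ^ (t + 1) - 1) =
      (∏ i ∈ range t, (v ^ t - v ^ i) / (v ^ t - 1)) *
        (1 - ((v ^ (t + 1) - 1) / (v - 1))⁻¹) ^ t := by
  have h₁ : v ^ (t + 1) - 1 ≠ 0 := (sub_pos.2 (one_lt_pow₀ hv t.succ_ne_zero)).ne'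
  have h₂ : v ^ t - 1 ≠ 0 := (sub_pos.2 (one_lt_pow₀ hv ht)).ne'
  have h₃ : v - 1 ≠ 0 := (sub_pos.2 hv).ne'
  rw [prod_range_succ', pow_zero, div_self h₁, mul_one]
  have hprod : ∀ b : ℝ, b ^ t = ∏ _i ∈ range t, b := by simp
  rw [hprod (1 - _), ← prod_mul_distrib]
  refine prod_congr rfl fun i _ => ?_
  field_simp
  ring

/-- Two columns of `K` are adjacent when they lie in a common covered `t`-subset of `K`. -/
def coveredGraph (A : ρ → C → S) (R : Finset ρ) (K : Finset C) (t : ℕ) : SimpleGraph C where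
  Adj i j := i ≠ j ∧ ∃ Q ⊆ K, #Q = t ∧ CoversOn A R Q ∧ i ∈ Q ∧ j ∈ Q
  symm := ⟨fun _ _ ⟨hij, Q, hQK, hQ, hc, hi, hj⟩ => ⟨hij.symm, Q, hQK, hQ, hc, hj, hi⟩⟩
  loopless := ⟨fun _ h => h.1 rfl⟩

theorem card_le_of_isClique_coveredGraph [Fintype S] {A : ρ → C → S} {R : Finset ρ}
    {K B : Finset C} {n : ℕ} (hS : 2 ≤ Fintype.card S) (hR : #R = Fintype.card S ^ (n + 2))
    (hB : (coveredGraph A R K (n + 2)).IsClique B) :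
    (#B : ℝ) ≤ ((Fintype.card S : ℝ) ^ (n + 2) - 1) / (Fintype.card S - 1) := by
  have : Nonempty S := Fintype.card_pos_iff.1 (by omega)
  have hv : (2 : ℝ) ≤ Fintype.card S := by exact_mod_cast hS
  rw [le_div_iff₀ (by linarith)]
  rcases le_or_gt #B 1 with hB1 | hB1
  · have hB1' : (#B : ℝ) ≤ 1 := by exact_mod_cast hB1
    have : (Fintype.card S : ℝ) ≤ (Fintype.card S : ℝ) ^ (n + 2) :=
      le_self_pow₀ (by linarith) (by omega)
    nlinarith
  · have key := card_mul_le_of_pairwise_orthogonal (A := A) (R := R) (B := B)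
      (u := Fintype.card S ^ n) (v := Fintype.card S) (Nat.one_le_pow _ _ (by omega)) hS
      (by rw [hR, pow_add]) ?_ ?_
    · rw [pow_add]
      exact_mod_cast key
    · intro i hi s
      obtain ⟨j, hj, hji⟩ := exists_mem_ne hB1 i
      obtain ⟨_, Q, _, hQ, hc, hiQ, _⟩ := hB hi hj hji.symm
      rw [hc.card_filter hQ hR hiQ, pow_succ]
    · intro i hi j hj hij s s'
      obtain ⟨_, Q, _, hQ, hc, hiQ, hjQ⟩ := hB hi hj hij
      exact hc.card_filter_filter hQ hR hiQ hjQ hij s s'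

theorem card_covered_le [Fintype S] (hS : 2 ≤ Fintype.card S) (A : ρ → C → S) {t : ℕ}
    (ht : 1 ≤ t) (R : Finset ρ) (hR : #R = Fintype.card S ^ t) (K : Finset C) :
    (#{Q ∈ K.powersetCard t | CoversOn A R Q} : ℝ) ≤
      (∏ i ∈ range t, ((Fintype.card S : ℝ) ^ t - (Fintype.card S : ℝ) ^ i) /
        ((Fintype.card S : ℝ) ^ t - 1)) * (#K : ℝ) ^ t / (t.factorial : ℝ) := by
  have hne : Nonempty S := Fintype.card_pos_iff.1 (by omega)
  have hv : (2 : ℝ) ≤ Fintype.card S := by exact_mod_cast hS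
  induction t, ht using Nat.le_induction generalizing R K with
  | base =>
    have hle := card_filter_le (K.powersetCard 1) (CoversOn A R)
    rw [card_powersetCard, Nat.choose_one_right] at hle
    have : (Fintype.card S : ℝ) - 1 ≠ 0 := by linarith
    simpa [div_self this] using hle
  | succ t ht ih =>
    obtain ⟨n, rfl⟩ : ∃ n, t = n + 1 := ⟨t - 1, by omega⟩
    set v : ℝ := (Fintype.card S : ℝ) with hvdef
    set c := ∏ i ∈ range (n + 1), (v ^ (n + 1) - v ^ i) / (v ^ (n + 1) - 1) with hc
    set F := {Q ∈ K.powersetCard (n + 1 + 1) | CoversOn A R Q} with hF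
    let G := coveredGraph A R K (n + 2)
    let d : C → ℝ := fun j => #{i ∈ K | G.Adj j i}
    have hc0 : 0 ≤ c := prod_nonneg fun i hi => by
      have h1 : v ^ i ≤ v ^ (n + 1) := pow_le_pow_right₀ (by linarith) (mem_range.1 hi).le
      have h2 : 1 ≤ v ^ (n + 1) := one_le_pow₀ (by linarith)
      exact div_nonneg (by linarith) (by linarith)
    have hFmem : ∀ {Q}, Q ∈ F ↔ (Q ⊆ K ∧ #Q = n + 2) ∧ CoversOn A R Q := by
      intro Q
      rw [hF, mem_filter, mem_powersetCard]
    -- double counting of the incidences between columns and covered sets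
    have hdouble : ((n + 2 : ℕ) : ℝ) * #F = ∑ j ∈ K, (#{Q ∈ F | j ∈ Q} : ℝ) := by
      have : ∑ j ∈ K, #{Q ∈ F | j ∈ Q} = ∑ Q ∈ F, #{j ∈ K | j ∈ Q} :=
        sum_card_bipartiteAbove_eq_sum_card_bipartiteBelow _
      have h2 : ∑ Q ∈ F, #{j ∈ K | j ∈ Q} = ∑ Q ∈ F, (n + 2) := sum_congr rfl fun Q hQ => by
        obtain ⟨⟨hQK, hQc⟩, _⟩ := hFmem.1 hQ
        rw [filter_mem_eq_inter, inter_eq_right.2 hQK, hQc]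
      rw [h2, sum_const, smul_eq_mul, mul_comm] at this
      exact_mod_cast this.symm
    have hlocal : ∀ j ∈ K, (#{Q ∈ F | j ∈ Q} : ℝ) ≤
        c / ((n + 1).factorial : ℝ) * d j ^ (n + 1) := by
      intro j _
      rcases ({Q ∈ F | j ∈ Q}).eq_empty_or_nonempty with hem | ⟨Q₀, hQ₀⟩
      · rw [hem, card_empty, Nat.cast_zero]
        positivity
      obtain ⟨hQ₀F, hjQ₀⟩ := mem_filter.1 hQ₀
      obtain ⟨⟨_, hQ₀c⟩, hQ₀cov⟩ := hFmem.1 hQ₀F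
      let s : S := Classical.arbitrary S
      have hRs := hQ₀cov.card_filter hQ₀c hR hjQ₀ s
      have hrec := ih {r ∈ R | A r j = s} hRs {i ∈ K | G.Adj j i}
      rw [mul_div_right_comm] at hrec
      refine le_trans ?_ hrec
      norm_cast
      refine card_le_card_of_injOn (fun Q => Q.erase j) ?_ ?_
      · intro Q hQ
        obtain ⟨hQF, hjQ⟩ := mem_filter.1 hQ
        obtain ⟨⟨hQK, hQc⟩, hQcov⟩ := hFmem.1 hQF
        refine mem_filter.2 ⟨mem_powersetCard.2 ⟨fun i hi => ?_, ?_⟩, hQcov.filter hjQ s⟩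
        · obtain ⟨hij, hiQ⟩ := mem_erase.1 hi
          exact mem_filter.2 ⟨hQK hiQ, hij.symm, Q, hQK, hQc, hQcov, hjQ, hiQ⟩
        · rw [card_erase_of_mem hjQ, hQc]
          rfl
      · intro Q hQ Q' hQ' heq
        rw [← insert_erase (mem_filter.1 hQ).2, ← insert_erase (mem_filter.1 hQ').2]
        exact congrArg (insert j) heq
    have hcompl : ∀ j, (#K : ℝ) - d j = #{i ∈ K | ¬ G.Adj j i} := by
      intro j
      rw [sub_eq_iff_eq_add', ← Nat.cast_add, Nat.cast_inj]
      exact (card_filter_add_card_filter_not (s := K) (fun i => G.Adj j i)).symm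
    have hpow : ∑ j ∈ K, d j ^ (n + 1) ≤
        #K * (#K * (1 - ((v ^ (n + 2) - 1) / (v - 1))⁻¹)) ^ (n + 1) := by
      refine sum_pow_le_of_sum_inv_le n ?_ (fun j _ => Nat.cast_nonneg _) ?_ ?_
      · rw [← geom_sum_eq (by linarith)]
        calc (n + 1 : ℝ) ≤ ∑ _i ∈ range (n + 2), (1 : ℝ) := by simp
          _ ≤ _ := sum_le_sum fun i _ => one_le_pow₀ (by linarith)
      · intro j hj
        rw [← sub_pos, hcompl]
        exact_mod_cast card_pos.2 ⟨j, mem_filter.2 ⟨hj, G.loopless.irrefl j⟩⟩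
      · obtain ⟨B, _, hB, hle⟩ := exists_clique_sum_inv_le G K
        simp_rw [hcompl]
        exact hle.trans (card_le_of_isClique_coveredGraph hS hR hB)
    rw [prod_range_succ_pow_sub_div (by linarith) (by omega : n + 1 ≠ 0), ← hc,
      Nat.factorial_succ (n + 1), le_div_iff₀ (by positivity)]
    calc (#F : ℝ) * ((n + 1 + 1) * (n + 1).factorial : ℕ)
        = (∑ j ∈ K, (#{Q ∈ F | j ∈ Q} : ℝ)) * (n + 1).factorial := by
          rw [← hdouble]; push_cast; ring
      _ ≤ (∑ j ∈ K, c / ((n + 1).factorial : ℝ) * d j ^ (n + 1)) * (n + 1).factorial := by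
          gcongr with j hj
          exact hlocal j hj
      _ = c * ∑ j ∈ K, d j ^ (n + 1) := by
          rw [← mul_sum]; field_simp
      _ ≤ c * (#K * (#K * (1 - ((v ^ (n + 2) - 1) / (v - 1))⁻¹)) ^ (n + 1)) := by gcongr
      _ = _ := by rw [mul_pow, pow_succ _ (n + 1)]; ring

end

/-- Every `v^t × k` array over a `v`-symbol alphabet covers at most
`c_{t,v} · k^t / t!` of the `t`-subsets of its columns, where
`c_{t,v} = ∏_{i=0}^{t-1} (v^t - v^i)/(v^t - 1)`. -/
theorem covered_tsets_upper_bound (t v k : ℕ) (ht : 2 ≤ t) (hv : 2 ≤ v) (hk : t ≤ k)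
    (S : Type*) [Fintype S] (hS : Fintype.card S = v)
    (A : Fin (v ^ t) → Fin k → S) :
    ({Q : Finset (Fin k) | Q.card = t ∧ Covers A Q}.ncard : ℝ)
      ≤ (∏ i ∈ Finset.range t, ((v : ℝ) ^ t - (v : ℝ) ^ i) / ((v : ℝ) ^ t - 1)) *
          (k : ℝ) ^ t / (Nat.factorial t : ℝ) := by
  classical
  subst hS
  have h := card_covered_le hv A (by omega : 1 ≤ t) Finset.univ (by simp) Finset.univ
  rw [Finset.card_univ, Fintype.card_fin] at h
  convert h using 2
  rw [← Set.ncard_coe_finset]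
  congr 1
  ext Q
  simp [Covers, CoversOn, Finset.mem_powersetCard]
end

section
/- For all t ≥ 1 and v ≥ 2, the Lagrangian of the hypergraph H_{t,v} satisfies λ(H_{t,v}) ≤ c_{t,v}/t! = (1/t!) · ∏_{i=0}^{t−1} (v^t − v^i)/(v^t − 1). -/
/-- A legal weighting: nonnegative weights summing to 1. -/
def IsLegalWeighting {U : Type*} [Fintype U] (x : U → ℝ) : Prop :=
  (∀ u, 0 ≤ x u) ∧ ∑ u, x u = 1

/-- The weight polynomial of a hypergraph evaluated at a weighting. -/
def weightPoly {U : Type*} [Fintype U] (H : Finset (Finset U)) (x : U → ℝ) : ℝ :=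
  ∑ e ∈ H, ∏ u ∈ e, x u

/-- The Lagrangian of a hypergraph. -/
noncomputable def lagrangian {U : Type*} [Fintype U] (H : Finset (Finset U)) : ℝ :=
  sSup {w | ∃ x, IsLegalWeighting x ∧ weightPoly H x = w}

open Classical in
/-- The hypergraph `H_{t,v}`: vertices are vectors in `[v]^{v^t}` and edges are the
`t`-sets of vectors whose columns form a `v^t × t` matrix containing every vector of
`[v]^t` among its rows. -/
noncomputable def Htv (t v : ℕ) : Finset (Finset (Fin (v ^ t) → Fin v)) :=
  Finset.univ.filter fun e => e.card = t ∧
    ∀ g : (Fin (v ^ t) → Fin v) → Fin v, ∃ r : Fin (v ^ t), ∀ y ∈ e, y r = g y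

/-- A family of columns covers when every pattern of symbols occurs in some row. -/
def IsCovering {ι R A : Type*} (Y : ι → R → A) : Prop :=
  Function.Surjective fun r i => Y i r

/-- Every pair of symbols occurs in exactly `m` rows of the two columns `y`, `z`. -/
def IsOrthogonal {R A : Type*} (m : ℕ) (y z : R → A) : Prop :=
  ∀ a b, Nat.card {r // y r = a ∧ z r = b} = m

open Classical in
/-- The total weight of the covering `t`-tuples of columns. -/
noncomputable def coverWeight {Ω R A : Type*} [Fintype Ω] (t : ℕ) (Y : Ω → R → A)
    (x : Ω → ℝ) : ℝ :=
  ∑ ω : Fin t → Ω, if IsCovering (fun i => Y (ω i)) then ∏ i, x (ω i) else 0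

/-- The constant `c_{t,v}`. -/
noncomputable def coverConst (v : ℝ) (t : ℕ) : ℝ :=
  ∏ i ∈ Finset.range t, (v ^ t - v ^ i) / (v ^ t - 1)

theorem coverConst_succ {v : ℝ} (hv : 1 < v) (k : ℕ) :
    coverConst v (k + 2) =
      coverConst v (k + 1) * (1 - (v - 1) / (v ^ (k + 2) - 1)) ^ (k + 1) := by
  have h1 : v ^ (k + 1) - 1 ≠ 0 := (sub_pos.2 (one_lt_pow₀ hv (by simp))).ne'
  have h2 : v ^ (k + 2) - 1 ≠ 0 := (sub_pos.2 (one_lt_pow₀ hv (by simp))).ne'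
  unfold coverConst
  rw [Finset.prod_range_succ', pow_zero, div_self h2, mul_one]
  have hp := Finset.prod_const (s := Finset.range (k + 1)) (1 - (v - 1) / (v ^ (k + 2) - 1))
  rw [Finset.card_range] at hp
  rw [← hp, ← Finset.prod_mul_distrib]
  refine Finset.prod_congr rfl fun i _ => ?_
  field_simp
  ring

theorem coverConst_one {v : ℝ} (hv : 1 < v) : coverConst v 1 = 1 := by
  simp [coverConst, div_self (sub_pos.2 hv).ne']

theorem coverConst_nonneg {v : ℝ} (hv : 1 < v) (t : ℕ) : 0 ≤ coverConst v t := by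
  refine Finset.prod_nonneg fun i hi => div_nonneg ?_ ?_
  · exact sub_nonneg.2 (pow_le_pow_right₀ hv.le (Finset.mem_range.1 hi).le)
  · exact sub_nonneg.2 (one_le_pow₀ hv.le)

/-- A tangent-line bound for `u * (1 - u) ^ (k + 1)` at `u = a`, divided by `u`. -/
theorem one_sub_pow_le_tangent {a u : ℝ} (ha : 0 ≤ a) (hu : 0 < u) (hu1 : u ≤ 1) (k : ℕ)
    (hk : (k + 1) * a ≤ 1) :
    (1 - u) ^ (k + 1) ≤ (1 - a) ^ k * (1 - a - (k + 1) * a * ((u - a) / u)) := by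
  induction k with
  | zero =>
    have : 0 ≤ (u - a) ^ 2 / u := by positivity
    have e : (u - a) ^ 2 / u = (u - a) - a * ((u - a) / u) := by field_simp
    norm_num
    linarith
  | succ k ih =>
    push_cast at hk ⊢
    have hka : 0 ≤ (k : ℝ) * a := by positivity
    have h1 : 0 ≤ 1 - a := by nlinarith
    have ih' := mul_le_mul_of_nonneg_right (ih (by nlinarith)) (sub_nonneg.2 hu1)
    rw [pow_succ]
    refine ih'.trans ?_
    rw [pow_succ (1 - a) k, mul_assoc _ _ (1 - u), mul_assoc _ (1 - a)]
    refine mul_le_mul_of_nonneg_left ?_ (pow_nonneg h1 k)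
    have h2 : 0 ≤ (u - a) ^ 2 / u * (1 - a - (k + 1) * a) :=
      mul_nonneg (by positivity) (by linarith)
    have e : (u - a) ^ 2 / u * (1 - a - (k + 1) * a) =
        (1 - a) * (1 - a - (k + 1 + 1) * a * ((u - a) / u)) -
        (1 - a - (k + 1) * a * ((u - a) / u)) * (1 - u) := by
      field_simp
      ring
    linarith

open Classical in
/-- The weighted Caro–Wei bound. -/
theorem exists_pairwise_sum_div_le_card {Ω : Type*} (r : Ω → Ω → Prop) (hr : ∀ y, r y y)
    (hsymm : ∀ y z, r y z → r z y) (x : Ω → ℝ) (hx : ∀ y, 0 ≤ x y) (s : Finset Ω) :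
    ∃ S ⊆ s, (∀ y ∈ S, ∀ z ∈ S, y ≠ z → ¬ r y z) ∧
      ∑ y ∈ s, x y / ∑ z ∈ s with r y z, x z ≤ S.card := by
  induction s using Finset.strongInduction with
  | H s ih =>
  rcases s.eq_empty_or_nonempty with rfl | hs
  · exact ⟨∅, by simp⟩
  obtain ⟨y, hy, hmin⟩ := s.exists_min_image (fun y => ∑ z ∈ s with r y z, x z) hs
  have hss : s.filter (fun z => ¬ r y z) ⊂ s :=
    Finset.filter_ssubset.2 ⟨y, hy, fun h => h (hr y)⟩
  obtain ⟨S, hS, hind, hle⟩ := ih _ hss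
  have hSr : ∀ z ∈ S, ¬ r y z := fun z hz => (Finset.mem_filter.1 (hS hz)).2
  refine ⟨insert y S, Finset.insert_subset hy (hS.trans hss.subset), ?_, ?_⟩
  · intro a ha b hb hab
    rcases Finset.mem_insert.1 ha with rfl | ha' <;>
      rcases Finset.mem_insert.1 hb with rfl | hb'
    · exact absurd rfl hab
    · exact hSr b hb'
    · exact fun h => hSr a ha' (hsymm _ _ h)
    · exact hind a ha' b hb' hab
  · rw [Finset.card_insert_of_notMem fun h => hSr y h (hr y), Nat.cast_add, Nat.cast_one,
      ← Finset.sum_filter_add_sum_filter_not s (r y), add_comm]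
    refine add_le_add (le_trans ?_ hle) ?_
    · refine Finset.sum_le_sum fun z hz => ?_
      have hmem : z ∈ (s.filter fun z => ¬ r y z).filter (r z) :=
        Finset.mem_filter.2 ⟨hz, hr z⟩
      have hxz := Finset.single_le_sum (f := x) (fun w _ => hx w) hmem
      rcases (hx z).eq_or_lt with h0 | h0
      · simp [← h0]
      · refine div_le_div_of_nonneg_left (hx z) (h0.trans_le hxz) ?_
        exact Finset.sum_le_sum_of_subset_of_nonneg
          (Finset.filter_subset_filter _ hss.subset) fun w _ _ => hx w
    · rcases (Finset.sum_nonneg fun z (_ : z ∈ s.filter (r y)) => hx z).eq_or_lt with h0 | h0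
      · have hz := (Finset.sum_eq_zero_iff_of_nonneg fun z _ => hx z).1 h0.symm
        rw [Finset.sum_eq_zero fun z hz' => by rw [hz z hz', zero_div]]
        exact zero_le_one
      · refine le_trans (Finset.sum_le_sum fun z hz => ?_)
          (Finset.sum_div _ x _ ▸ div_self_le_one (∑ z ∈ s with r y z, x z))
        exact div_le_div_of_nonneg_left (hx z) h0 (hmin z (Finset.mem_filter.1 hz).1)

theorem IsOrthogonal.symm {R A : Type*} {m : ℕ} {y z : R → A} (h : IsOrthogonal m y z) :
    IsOrthogonal m z y := fun a b => by
  simpa only [and_comm] using h b a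

theorem not_isOrthogonal_self {R : Type*} {m v : ℕ} (hm : m ≠ 0) (hv : 2 ≤ v)
    (y : R → Fin v) : ¬ IsOrthogonal m y y := fun h => by
  have := h ⟨0, by omega⟩ ⟨1, by omega⟩
  rw [Nat.card_eq_zero.2 (Or.inl ⟨fun r => by
    have := r.2.1.symm.trans r.2.2
    simp at this⟩)] at this
  exact hm this.symm

open Classical in
theorem IsOrthogonal.sum_ite {R : Type*} [Fintype R] {m v : ℕ} {y z : R → Fin v}
    (h : IsOrthogonal m y z) (a b : Fin v) :
    ∑ r, (if y r = a then (1 : ℝ) else 0) * (if z r = b then 1 else 0) = m := by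
  rw [← h a b, Nat.card_eq_fintype_card, Fintype.card_subtype, Finset.card_filter]
  push_cast
  exact Finset.sum_congr rfl fun r _ => by split_ifs <;> simp_all

open Classical in
theorem IsOrthogonal.sum_ite_left {R : Type*} [Fintype R] {m v : ℕ} {y z : R → Fin v}
    (h : IsOrthogonal m y z) (a : Fin v) :
    ∑ r, (if y r = a then (1 : ℝ) else 0) = v * m := by
  have := Finset.sum_congr rfl fun b (_ : b ∈ Finset.univ) => h.sum_ite a b
  rw [Finset.sum_comm] at this
  simpa [← Finset.mul_sum] using this

theorem IsOrthogonal.card_fiber {R : Type*} [Fintype R] {m v : ℕ} {y z : R → Fin v}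
    (h : IsOrthogonal m y z) (a : Fin v) : Nat.card {r // y r = a} = v * m := by
  classical
  have := h.sum_ite_left a
  rw [Finset.sum_boole] at this
  rw [Nat.card_eq_fintype_card, Fintype.card_subtype]
  exact_mod_cast this

open Classical in
/-- Rao's bound on the number of pairwise orthogonal columns. -/
theorem card_mul_le_of_pairwise_isOrthogonal {Ω R : Type*} [Fintype R] {m v : ℕ} (hv : 2 ≤ v)
    (hm : m ≠ 0) (hR : Fintype.card R = v ^ 2 * m) (Y : Ω → R → Fin v) (S : Finset Ω)
    (hS : ∀ y ∈ S, ∀ z ∈ S, y ≠ z → IsOrthogonal m (Y y) (Y z)) :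
    (S.card : ℝ) * (v - 1) ≤ v ^ 2 * m - 1 := by
  have hv' : (2 : ℝ) ≤ v := by exact_mod_cast hv
  have hm' : (1 : ℝ) ≤ m := by exact_mod_cast Nat.one_le_iff_ne_zero.2 hm
  rcases Nat.lt_or_ge 1 S.card with hc | hc
  swap
  · have : (S.card : ℝ) ≤ 1 := by exact_mod_cast hc
    nlinarith
  have : Nonempty R := Fintype.card_pos_iff.1 (by rw [hR]; positivity)
  obtain ⟨r₀⟩ := this
  have hRr : ∑ _r : R, (1 : ℝ) = v ^ 2 * m := by
    rw [Finset.sum_const, Finset.card_univ, hR]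
    simp
  have hbal : ∀ y ∈ S, ∑ r, (if Y y r = Y y r₀ then (1 : ℝ) else 0) = v * m := fun y hy => by
    obtain ⟨z, hz, hzy⟩ := Finset.exists_mem_ne hc y
    exact (hS y hy z hz hzy.symm).sum_ite_left _
  let f : Ω → R → ℝ := fun y r => v * (if Y y r = Y y r₀ then (1 : ℝ) else 0) - 1
  have hf : ∀ y ∈ S, ∑ r, f y r = 0 := fun y hy => by
    simp only [f, Finset.sum_sub_distrib, ← Finset.mul_sum, hbal y hy, hRr]
    ring
  have hff : ∀ y ∈ S, ∀ z ∈ S, ∑ r, f y r * f z r =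
      if y = z then (v : ℝ) ^ 2 * m * (v - 1) else 0 := fun y hy z hz => by
    have e : ∀ r, f y r * f z r = v ^ 2 * ((if Y y r = Y y r₀ then (1 : ℝ) else 0) *
        (if Y z r = Y z r₀ then (1 : ℝ) else 0)) -
        v * (if Y y r = Y y r₀ then (1 : ℝ) else 0) -
        v * (if Y z r = Y z r₀ then (1 : ℝ) else 0) + 1 := fun r => by
      simp only [f]
      ring
    simp only [e, Finset.sum_add_distrib, Finset.sum_sub_distrib, ← Finset.mul_sum,
      hbal y hy, hbal z hz, hRr]
    split_ifs with hyz
    · subst hyz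
      have : ∑ r, (if Y y r = Y y r₀ then (1 : ℝ) else 0) *
          (if Y y r = Y y r₀ then (1 : ℝ) else 0) = v * m := by
        rw [← hbal y hy]
        exact Finset.sum_congr rfl fun r _ => by split_ifs <;> simp
      rw [this]
      ring
    · rw [(hS y hy z hz hyz).sum_ite]
      ring
  have hsq : ∑ r, (1 + ∑ y ∈ S, f y r) ^ 2 =
      (v : ℝ) ^ 2 * m * (1 + S.card * (v - 1)) := by
    have e : ∀ r, (1 + ∑ y ∈ S, f y r) ^ 2 =
        1 + 2 * ∑ y ∈ S, f y r + ∑ y ∈ S, ∑ z ∈ S, f y r * f z r := fun r => by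
      rw [← Finset.sum_mul_sum]
      ring
    simp only [e, Finset.sum_add_distrib, hRr]
    rw [← Finset.mul_sum, Finset.sum_comm, Finset.sum_eq_zero hf, Finset.sum_comm,
      Finset.sum_congr rfl fun y _ => Finset.sum_comm, Finset.sum_congr rfl fun y hy => Finset.sum_congr rfl fun z hz => hff y hy z hz]
    simp only [Finset.sum_ite_eq, Finset.sum_ite_mem, Finset.inter_self, Finset.sum_const,
      nsmul_eq_mul]
    ring
  have hle := Finset.single_le_sum (f := fun r => (1 + ∑ y ∈ S, f y r) ^ 2)
    (fun r _ => sq_nonneg _) (Finset.mem_univ r₀)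
  rw [hsq] at hle
  have h₀ : ∑ y ∈ S, f y r₀ = S.card * (v - 1) := by
    simp only [f, if_true, mul_one, Finset.sum_const, nsmul_eq_mul]
  simp only [h₀] at hle
  have hpos : 0 < 1 + (S.card : ℝ) * (v - 1) := by
    have : 0 ≤ (S.card : ℝ) * (v - 1) := mul_nonneg (by positivity) (by linarith)
    linarith
  have := le_of_mul_le_mul_right (sq (1 + (S.card : ℝ) * (v - 1)) ▸ hle) hpos
  linarith

theorem coverWeight_smul {Ω R A : Type*} [Fintype Ω] (t : ℕ) (Y : Ω → R → A) (x : Ω → ℝ)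
    (c : ℝ) : coverWeight t Y (fun o => c * x o) = c ^ t * coverWeight t Y x := by
  simp [coverWeight, Finset.mul_sum, Finset.prod_mul_distrib]

theorem IsCovering.isOrthogonal {R : Type*} [Fintype R] {k v : ℕ}
    (hR : Fintype.card R = v ^ (k + 2)) {y : R → Fin v} {Z : Fin (k + 1) → R → Fin v}
    (h : IsCovering (Fin.cons y Z : Fin (k + 2) → R → Fin v)) (j : Fin (k + 1)) :
    IsOrthogonal (v ^ k) y (Z j) := by
  intro a b
  have hb : Function.Bijective
      fun r i => (Fin.cons y Z : Fin (k + 2) → R → Fin v) i r :=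
    (Fintype.bijective_iff_surjective_and_card _).2 ⟨h, by simp [hR]⟩
  let s : Fin (k + 2) → Finset (Fin v) :=
    Fin.cons {a} fun i => if i = j then {b} else Finset.univ
  have e : {r // y r = a ∧ Z j r = b} ≃ Fintype.piFinset s :=
    (Equiv.ofBijective _ hb).subtypeEquiv fun r => by
      simp only [s, Equiv.ofBijective_apply, Fintype.mem_piFinset,
        Fin.forall_fin_succ (n := k + 1), Fin.cons_zero, Fin.cons_succ, Finset.mem_singleton]
      refine and_congr_right fun _ => ⟨fun hr i => ?_, fun hr => by simpa using hr j⟩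
      split_ifs with hi
      · simp [hi, hr]
      · simp
  rw [Nat.card_congr e, Nat.card_eq_fintype_card, Fintype.card_coe, Fintype.card_piFinset,
    Fin.prod_univ_succ, Fin.prod_univ_succAbove _ j]
  simp [s, Fin.succAbove_ne]

open Classical in
theorem coverWeight_succ_le {Ω R : Type*} [Fintype Ω] [Fintype R] {k v : ℕ}
    (hR : Fintype.card R = v ^ (k + 2)) (a : Fin v) (Y : Ω → R → Fin v) (x : Ω → ℝ)
    (hx : ∀ o, 0 ≤ x o) :
    coverWeight (k + 2) Y x ≤ ∑ o, x o *
      coverWeight (k + 1) (fun p (r : {r // Y o r = a}) => Y p r)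
        (fun p => if IsOrthogonal (v ^ k) (Y o) (Y p) then x p else 0) := by
  unfold coverWeight
  rw [← (Fin.consEquiv fun _ => Ω).sum_comp, Fintype.sum_prod_type]
  refine Finset.sum_le_sum fun o _ => ?_
  rw [Finset.mul_sum]
  refine Finset.sum_le_sum fun ω _ => ?_
  have hω : (fun i => Y ((Fin.consEquiv fun _ => Ω) (o, ω) i)) =
      (Fin.cons (Y o) fun i => Y (ω i) : Fin (k + 2) → R → Fin v) := by
    funext i
    refine Fin.cases ?_ (fun i => ?_) i <;> simp [Fin.consEquiv]
  rw [hω]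
  split_ifs with h1 h2 h2
  · have := fun j => h1.isOrthogonal hR j
    simp [Fin.consEquiv, Fin.prod_univ_succ, this]
  · refine absurd (fun g => ?_) h2
    obtain ⟨r, hr⟩ := h1 (Fin.cons a g)
    exact ⟨⟨r, by simpa using congrFun hr 0⟩, funext fun i => by simpa using congrFun hr i.succ⟩
  · exact mul_nonneg (hx o) (Finset.prod_nonneg fun i _ => by
      beta_reduce
      split_ifs <;> simp [hx])
  · simp

theorem coverWeight_le_of_normalized {Ω R A : Type*} [Fintype Ω] {t : ℕ} {Y : Ω → R → A}
    {c : ℝ} (ht : t ≠ 0)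
    (h : ∀ x : Ω → ℝ, (∀ o, 0 ≤ x o) → ∑ o, x o = 1 → coverWeight t Y x ≤ c)
    (x : Ω → ℝ) (hx : ∀ o, 0 ≤ x o) : coverWeight t Y x ≤ c * (∑ o, x o) ^ t := by
  rcases (Finset.sum_nonneg fun o (_ : o ∈ Finset.univ) => hx o).eq_or_lt with h0 | h0
  · have hz := (Finset.sum_eq_zero_iff_of_nonneg fun o _ => hx o).1 h0.symm
    have : x = fun o => 0 * x o := funext fun o => by simp [hz o]
    rw [← h0, this, coverWeight_smul]
    simp [ht]
  · have h1 := h (fun o => (∑ o, x o)⁻¹ * x o)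
      (fun o => mul_nonneg (inv_nonneg.2 h0.le) (hx o))
      (by rw [← Finset.mul_sum, inv_mul_cancel₀ h0.ne'])
    rw [coverWeight_smul, inv_pow, inv_mul_le_iff₀ (by positivity)] at h1
    linarith

open Classical in
theorem coverWeight_zero {Ω R A : Type*} [Fintype Ω] {t : ℕ} (Y : Ω → R → A) :
    coverWeight (t + 1) Y (fun _ => 0) = 0 := by
  simp [coverWeight]

open Classical in
/-- Averaging the Caro–Wei and Rao bounds through the tangent line. -/
theorem sum_mul_pow_orthogonal_le {Ω R : Type*} [Fintype Ω] [Fintype R] {k v : ℕ} (hv : 2 ≤ v)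
    (hR : Fintype.card R = v ^ (k + 2)) (Y : Ω → R → Fin v) (x : Ω → ℝ) (hx : ∀ o, 0 ≤ x o)
    (hx1 : ∑ o, x o = 1) :
    ∑ o, x o * (∑ p, if IsOrthogonal (v ^ k) (Y o) (Y p) then x p else 0) ^ (k + 1) ≤
      (1 - ((v : ℝ) - 1) / (v ^ (k + 2) - 1)) ^ (k + 1) := by
  have hv' : (2 : ℝ) ≤ v := by exact_mod_cast hv
  have hm : v ^ k ≠ 0 := by positivity
  set a : ℝ := ((v : ℝ) - 1) / (v ^ (k + 2) - 1) with ha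
  have hN : (0 : ℝ) < (v : ℝ) ^ (k + 2) - 1 :=
    sub_pos.2 (one_lt_pow₀ (by linarith) (by simp))
  have ha0 : 0 < a := div_pos (by linarith) hN
  have hbern : 1 + ((k + 2 : ℕ) : ℝ) * (v - 1) ≤ (v : ℝ) ^ (k + 2) := by
    simpa using one_add_mul_le_pow (a := (v : ℝ) - 1) (by linarith) (k + 2)
  have hka : (k + 1) * a ≤ 1 := by
    rw [ha, ← mul_div_assoc, div_le_one hN]
    push_cast at hbern
    nlinarith
  have ha1 : a ≤ 1 := by nlinarith [mul_nonneg (Nat.cast_nonneg (α := ℝ) k) ha0.le]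
  let d : Ω → ℝ := fun o => ∑ p with ¬ IsOrthogonal (v ^ k) (Y o) (Y p), x p
  have hd : ∀ o, (∑ p, if IsOrthogonal (v ^ k) (Y o) (Y p) then x p else 0) = 1 - d o :=
    fun o => by
      rw [← Finset.sum_filter, ← hx1, ← Finset.sum_filter_add_sum_filter_not Finset.univ
        (fun p => IsOrthogonal (v ^ k) (Y o) (Y p)) x]
      simp [d]
  have hd1 : ∀ o, d o ≤ 1 := fun o => by
    rw [← hx1]
    exact Finset.sum_le_sum_of_subset_of_nonneg (Finset.filter_subset _ _) fun p _ _ => hx p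
  have hxd : ∀ o, x o ≤ d o := fun o =>
    Finset.single_le_sum (f := x) (fun p _ => hx p)
      (by simpa using not_isOrthogonal_self hm hv (Y o))
  have hcw : ∑ o, x o / d o ≤ 1 / a := by
    obtain ⟨S, -, hS, hle⟩ := exists_pairwise_sum_div_le_card
      (fun o p => ¬ IsOrthogonal (v ^ k) (Y o) (Y p))
      (fun o => not_isOrthogonal_self hm hv (Y o)) (fun o p h h' => h h'.symm) x hx Finset.univ
    refine le_trans (le_of_eq (by simp only [d]; congr!)) (hle.trans ?_)
    have := card_mul_le_of_pairwise_isOrthogonal hv hm (by rw [hR]; ring) Y S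
      fun y hy z hz hyz => not_not.1 (hS y hy z hz hyz)
    rw [ha, one_div_div, le_div_iff₀ (by linarith)]
    refine this.trans (le_of_eq ?_)
    push_cast
    ring
  calc _ = ∑ o, x o * (1 - d o) ^ (k + 1) := by simp only [hd]
    _ ≤ ∑ o, (1 - a) ^ k * ((1 - a - (k + 1) * a) * x o + (k + 1) * a ^ 2 * (x o / d o)) := by
      refine Finset.sum_le_sum fun o _ => ?_
      rcases (hx o).eq_or_lt with h0 | h0
      · simp [← h0]
      · have hdo := h0.trans_le (hxd o)
        refine (mul_le_mul_of_nonneg_left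
          (one_sub_pow_le_tangent ha0.le hdo (hd1 o) k hka) h0.le).trans (le_of_eq ?_)
        field_simp
        ring
    _ = (1 - a) ^ k * ((1 - a - (k + 1) * a) + (k + 1) * a ^ 2 * ∑ o, x o / d o) := by
      rw [← Finset.mul_sum, Finset.sum_add_distrib, ← Finset.mul_sum, ← Finset.mul_sum, hx1,
        mul_one]
    _ ≤ (1 - a) ^ k * ((1 - a - (k + 1) * a) + (k + 1) * a ^ 2 * (1 / a)) := by
      have := pow_nonneg (sub_nonneg.2 ha1) k
      gcongr
    _ = (1 - a) ^ (k + 1) := by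
      field_simp
      ring

theorem coverWeight_le {Ω : Type*} [Fintype Ω] {v : ℕ} (hv : 2 ≤ v) (k : ℕ) :
    ∀ {R : Type} [Fintype R], Fintype.card R = v ^ (k + 1) → ∀ (Y : Ω → R → Fin v) (x : Ω → ℝ),
      (∀ o, 0 ≤ x o) → ∑ o, x o = 1 → coverWeight (k + 1) Y x ≤ coverConst v (k + 1) := by
  classical
  have hv' : (1 : ℝ) < v := by exact_mod_cast hv
  induction k with
  | zero =>
    intro R _ _ Y x hx hx1
    rw [zero_add, coverConst_one hv', ← hx1, ← (Equiv.funUnique (Fin 1) Ω).sum_comp]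
    refine Finset.sum_le_sum fun ω _ => ?_
    split_ifs <;> simp [hx]
  | succ k ih =>
    intro R _ hR Y x hx hx1
    refine (coverWeight_succ_le hR ⟨0, by omega⟩ Y x hx).trans ?_
    rw [coverConst_succ hv']
    refine le_trans ?_ (mul_le_mul_of_nonneg_left
      (sum_mul_pow_orthogonal_le hv hR Y x hx hx1) (coverConst_nonneg hv' _))
    rw [Finset.mul_sum]
    refine Finset.sum_le_sum fun o _ => ?_
    rw [mul_left_comm]
    refine mul_le_mul_of_nonneg_left ?_ (hx o)
    by_cases ho : ∃ p, IsOrthogonal (v ^ k) (Y o) (Y p)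
    · obtain ⟨p, hp⟩ := ho
      refine coverWeight_le_of_normalized (by simp) (ih ?_ _) _ fun p => ?_
      · rw [← Nat.card_eq_fintype_card, hp.card_fiber, pow_succ']
      · split_ifs <;> simp [hx]
    · simp only [not_exists] at ho
      simp [ho, coverWeight_zero]

theorem factorial_mul_weightPoly_Htv_le (t v : ℕ) (x : (Fin (v ^ t) → Fin v) → ℝ)
    (hx : ∀ u, 0 ≤ x u) :
    (t.factorial : ℝ) * weightPoly (Htv t v) x ≤ coverWeight t id x := by
  classical
  have key : ∀ e ∈ Htv t v, (t.factorial : ℝ) * ∏ u ∈ e, x u ≤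
      ∑ ω : Fin t → Fin (v ^ t) → Fin v with Finset.univ.image ω = e,
        if IsCovering (fun i => id (ω i)) then ∏ i, x (ω i) else 0 := by
    intro e he
    obtain ⟨hc, hcov⟩ := (Finset.mem_filter.1 he).2
    have himg : ∀ σ : Fin t ≃ e, Finset.univ.image (fun i => (σ i : Fin (v ^ t) → Fin v)) = e :=
      fun σ => by
        ext u
        simp only [Finset.mem_image, Finset.mem_univ, true_and]
        exact ⟨fun ⟨i, hi⟩ => hi ▸ (σ i).2, fun hu => ⟨σ.symm ⟨u, hu⟩, by simp⟩⟩
    let F : (Fin t ≃ e) ↪ (Fin t → Fin (v ^ t) → Fin v) :=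
      ⟨fun σ i => σ i, fun σ τ h => Equiv.ext fun i => Subtype.ext (congrFun h i)⟩
    have hcard : Fintype.card (Fin t ≃ e) = t.factorial := by
      rw [Fintype.card_equiv (Fintype.equivOfCardEq (by simp [hc])), Fintype.card_fin]
    calc (t.factorial : ℝ) * ∏ u ∈ e, x u = ∑ _σ : Fin t ≃ e, ∏ u ∈ e, x u := by
          rw [Finset.sum_const, Finset.card_univ, hcard, nsmul_eq_mul]
      _ = ∑ ω ∈ Finset.univ.map F,
            if IsCovering (fun i => id (ω i)) then ∏ i, x (ω i) else 0 := by
        rw [Finset.sum_map]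
        refine Finset.sum_congr rfl fun σ _ => ?_
        have hσ : IsCovering fun i => id (F σ i) := fun g => by
          rcases Nat.eq_zero_or_pos v with rfl | hv
          · rcases Nat.eq_zero_or_pos t with rfl | ht
            · exact ⟨⟨0, by simp⟩, Subsingleton.elim _ _⟩
            · exact (g ⟨0, ht⟩).elim0
          · obtain ⟨r, hr⟩ := hcov fun u =>
              if hu : u ∈ e then g (σ.symm ⟨u, hu⟩) else ⟨0, hv⟩
            exact ⟨r, funext fun i => (hr _ (σ i).2).trans (by simp)⟩
        rw [if_pos hσ, ← Finset.prod_coe_sort e x, ← σ.prod_comp]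
        rfl
      _ ≤ _ := by
        refine Finset.sum_le_sum_of_subset_of_nonneg ?_ fun ω _ _ => ?_
        · intro ω hω
          obtain ⟨σ, -, rfl⟩ := Finset.mem_map.1 hω
          exact Finset.mem_filter.2 ⟨Finset.mem_univ _, himg σ⟩
        · split_ifs
          · exact Finset.prod_nonneg fun i _ => hx _
          · exact le_rfl
  rw [weightPoly, Finset.mul_sum]
  refine (Finset.sum_le_sum key).trans ?_
  unfold coverWeight
  rw [← Finset.sum_fiberwise Finset.univ fun ω : Fin t → Fin (v ^ t) → Fin v =>
    Finset.univ.image ω]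
  refine Finset.sum_le_sum_of_subset_of_nonneg (Finset.subset_univ _) fun e _ _ =>
    Finset.sum_nonneg fun ω _ => ?_
  split_ifs
  · exact Finset.prod_nonneg fun i _ => hx _
  · exact le_rfl

/-- For all `t ≥ 1` and `v ≥ 2`, `λ(H_{t,v}) ≤ c_{t,v}/t!`, where
`c_{t,v} = ∏_{i=0}^{t-1} (v^t - v^i)/(v^t - 1)`. -/
theorem lagrangian_Htv_le (t v : ℕ) (ht : 1 ≤ t) (hv : 2 ≤ v) :
    lagrangian (Htv t v) ≤
      (1 / (Nat.factorial t : ℝ)) *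
        ∏ i ∈ Finset.range t, ((v : ℝ) ^ t - (v : ℝ) ^ i) / ((v : ℝ) ^ t - 1) := by
  have hv' : (1 : ℝ) < v := by exact_mod_cast hv
  refine Real.sSup_le ?_ (mul_nonneg (by positivity) (coverConst_nonneg hv' t))
  rintro _ ⟨x, ⟨hx, hx1⟩, rfl⟩
  obtain ⟨k, rfl⟩ := Nat.exists_eq_add_of_le' ht
  rw [one_div, le_inv_mul_iff₀ (by positivity)]
  exact (factorial_mul_weightPoly_Htv_le _ v x hx).trans
    (coverWeight_le hv k (by simp) id x hx hx1)
end
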